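/- Let m ≥ 1 and n ≥ 1 be integers and p ∈ (0,1). For 0 ≤ k ≤ m−1 set S_k = ∑_{z=0}^{k} C(m−1,z)(1−p)^z p^{m−1−z} and S_{−1} = 0, and define π̃(k) = p^{n−1}·(S_k^n − S_{k−1}^n)/(n·(S_k − S_{k−1})). Then π̃(k) ≤ π̃(k') whenever 0 ≤ k ≤ k' ≤ m−1, and π̃(k) ≤ (1−p^n)/(n(1−p)) for every 0 ≤ k ≤ m−1. -/

import Mathlib

noncomputable section

/-- `Scum m p k = ∑_{z=0}^{k} C(m−1,z)(1−p)^z p^{m−1−z}`, i.e. `Pr[B(m−1,1−p) ≤ k]`. -/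
def Scum (m : ℕ) (p : ℝ) (k : ℕ) : ℝ :=
  ∑ z ∈ Finset.range (k + 1), (Nat.choose (m - 1) z : ℝ) * (1 - p) ^ z * p ^ (m - 1 - z)

/-- `Sprev m p k = S_{k-1}`, with the convention `S_{−1} = 0`. -/
def Sprev (m : ℕ) (p : ℝ) (k : ℕ) : ℝ :=
  if k = 0 then 0 else Scum m p (k - 1)

/-- `π̃(k) = p^{n−1}·(S_k^n − S_{k−1}^n)/(n·(S_k − S_{k−1}))`, the interim allocation
probability of the first-axis mechanism for a low-value item when `k` other items are
reported at the high value. -/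
def tildePi (m n : ℕ) (p : ℝ) (k : ℕ) : ℝ :=
  p ^ (n - 1) * (Scum m p k ^ n - Sprev m p k ^ n) /
    ((n : ℝ) * (Scum m p k - Sprev m p k))

theorem Scum_mono (m : ℕ) {p : ℝ} (hp0 : 0 ≤ p) (hp1 : p ≤ 1) : Monotone (Scum m p) := by
  intro a b hab
  have hq : 0 ≤ 1 - p := by linarith
  refine Finset.sum_le_sum_of_subset_of_nonneg
    (Finset.range_subset_range.2 (by omega)) fun i _ _ => by positivity

theorem Scum_nonneg (m : ℕ) {p : ℝ} (hp0 : 0 ≤ p) (hp1 : p ≤ 1) (k : ℕ) : 0 ≤ Scum m p k := by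
  have hq : 0 ≤ 1 - p := by linarith
  exact Finset.sum_nonneg fun i _ => by positivity

theorem Scum_pred_self (m : ℕ) (p : ℝ) : Scum m p (m - 1) = 1 := by
  have h := add_pow (1 - p) p (m - 1)
  rw [sub_add_cancel, one_pow] at h
  rw [h, Scum]
  exact Finset.sum_congr rfl fun i _ => by ring

theorem Scum_le_one {m : ℕ} {p : ℝ} (hp0 : 0 ≤ p) (hp1 : p ≤ 1) {k : ℕ} (hk : k ≤ m - 1) :
    Scum m p k ≤ 1 :=
  (Scum_mono m hp0 hp1 hk).trans_eq (Scum_pred_self m p)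

theorem Sprev_nonneg (m : ℕ) {p : ℝ} (hp0 : 0 ≤ p) (hp1 : p ≤ 1) (k : ℕ) : 0 ≤ Sprev m p k := by
  rw [Sprev]
  split_ifs
  exacts [le_rfl, Scum_nonneg m hp0 hp1 _]

theorem Sprev_mono (m : ℕ) {p : ℝ} (hp0 : 0 ≤ p) (hp1 : p ≤ 1) : Monotone (Sprev m p) := by
  intro a b hab
  rcases Nat.eq_zero_or_pos a with rfl | ha
  · simpa [Sprev] using Sprev_nonneg m hp0 hp1 b
  · rw [Sprev, Sprev, if_neg (by omega), if_neg (by omega)]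
    exact Scum_mono m hp0 hp1 (by omega)

theorem Sprev_le_one {m : ℕ} {p : ℝ} (hp0 : 0 ≤ p) (hp1 : p ≤ 1) {k : ℕ} (hk : k ≤ m - 1) :
    Sprev m p k ≤ 1 := by
  rw [Sprev]
  split_ifs
  exacts [zero_le_one, Scum_le_one hp0 hp1 (by omega)]

theorem Scum_sub_Sprev (m : ℕ) (p : ℝ) (k : ℕ) :
    Scum m p k - Sprev m p k = (Nat.choose (m - 1) k : ℝ) * (1 - p) ^ k * p ^ (m - 1 - k) := by
  cases k with
  | zero => simp [Scum, Sprev]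
  | succ k =>
    rw [Sprev, if_neg k.succ_ne_zero, Scum, Finset.sum_range_succ, Nat.add_sub_cancel, Scum,
      add_sub_cancel_left]

theorem tildePi_eq_geom_sum {m : ℕ} (n : ℕ) {p : ℝ} (hp0 : 0 < p) (hp1 : p < 1) {k : ℕ}
    (hk : k ≤ m - 1) :
    tildePi m n p k =
      p ^ (n - 1) * (∑ i ∈ Finset.range n, Scum m p k ^ i * Sprev m p k ^ (n - 1 - i)) / n := by
  have hd : Scum m p k - Sprev m p k ≠ 0 := by
    have hq : 0 < 1 - p := by linarith
    have hc : (0 : ℝ) < Nat.choose (m - 1) k := Nat.cast_pos.2 (Nat.choose_pos hk)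
    rw [Scum_sub_Sprev]
    positivity
  rw [tildePi, ← geom_sum₂_mul, ← mul_assoc, mul_div_mul_right _ _ hd]

/-- `π̃` is nondecreasing on `{0,…,m−1}` and bounded above by `(1−p^n)/(n(1−p))`,
the interim allocation probability for an item reported at the high value. -/
theorem tildePi_monotone_and_bounded (m n : ℕ) (hm : 1 ≤ m) (hn : 1 ≤ n)
    (p : ℝ) (hp0 : 0 < p) (hp1 : p < 1) :
    (∀ k k' : ℕ, k ≤ k' → k' ≤ m - 1 → tildePi m n p k ≤ tildePi m n p k') ∧
    (∀ k : ℕ, k ≤ m - 1 → tildePi m n p k ≤ (1 - p ^ n) / ((n : ℝ) * (1 - p))) := by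
  refine ⟨fun k k' hkk hk' => ?_, fun k hk => ?_⟩
  · rw [tildePi_eq_geom_sum n hp0 hp1 (hkk.trans hk'), tildePi_eq_geom_sum n hp0 hp1 hk']
    have hS := Scum_mono m hp0.le hp1.le hkk
    have hP := Sprev_mono m hp0.le hp1.le hkk
    have hS0 := Scum_nonneg m hp0.le hp1.le k
    have hP0 := Sprev_nonneg m hp0.le hp1.le k
    have hS0' := Scum_nonneg m hp0.le hp1.le k'
    gcongr
  · have hq : 0 < 1 - p := by linarith
    have hS0 := Scum_nonneg m hp0.le hp1.le k
    have hP0 := Sprev_nonneg m hp0.le hp1.le k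
    rw [tildePi_eq_geom_sum n hp0 hp1 hk, ← geom_sum_mul_neg p n, mul_div_mul_right _ _ hq.ne',
      Finset.mul_sum]
    gcongr with i hi
    have hi' : i < n := Finset.mem_range.1 hi
    calc p ^ (n - 1) * (Scum m p k ^ i * Sprev m p k ^ (n - 1 - i))
        ≤ p ^ (n - 1) * 1 := by
          gcongr
          exact mul_le_one₀ (pow_le_one₀ hS0 (Scum_le_one hp0.le hp1.le hk)) (by positivity)
            (pow_le_one₀ hP0 (Sprev_le_one hp0.le hp1.le hk))
      _ = p ^ (n - 1) := mul_one _
      _ ≤ p ^ i := pow_le_pow_of_le_one hp0.le hp1.le (by omega)
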